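/- Let M = (m_{ij}) ∈ ℝ^{n×n} be a B₁-matrix with decomposition M = A + C (so A = (a_{ij}) with a_{ij} = m_{ij} − r_i is SDD₁ and has positive diagonal entries), and suppose N₁(A) is nonempty and |N₂(A)| ≥ 2. Then for every diagonal matrix D = diag(d₁,…,d_n) with 0 ≤ d_i ≤ 1 for all i, the matrix I − D + DM is nonsingular and ‖(I − D + DM)⁻¹‖_∞ ≤ (n−1)·(1 + max_{i∈N₂(A)} P_i(A)/a_{ii}) · max{φ̃, ψ̃}, where φ̃ = max_{i,j∈N₂(A), i≠j} ( max{1, a_{jj}} + R_i^{N₂(A)}(A) ) / min{1, a_{ii}, a_{jj}, a_{ii}a_{jj} − R_i^{N₂(A)}(A)R_j^{N₂(A)}(A)} and ψ̃ = max_{i∈N₁(A)} (1 + φ̃·R_i^{N₂(A)}(A)) / min{1, a_{ii} − R_i^{N₁(A)}(A) − Σ_{j∈N₂(A)} (|a_{ij}|/a_{jj})·P_j(A)}. -/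

import Mathlib

open Finset Matrix
open scoped BigOperators Classical

/-- Row sum of absolute values of off-diagonal entries: `R_i(B)`, real version. -/
noncomputable def rowRR {m : Type*} [Fintype m] [DecidableEq m] (B : Matrix m m ℝ) (i : m) : ℝ :=
  ∑ j ∈ Finset.univ.erase i, |B i j|

/-- Partial row sum over an index set `S`: `R_i^S(B)`, real version. -/
noncomputable def rowRSR {m : Type*} [Fintype m] [DecidableEq m] (B : Matrix m m ℝ)
    (S : Finset m) (i : m) : ℝ :=
  ∑ j ∈ S.erase i, |B i j|

/-- Weighted partial row sum over an index set `S`: `Q_i^S(B)`, real version. -/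
noncomputable def rowQSR {m : Type*} [Fintype m] [DecidableEq m] (B : Matrix m m ℝ)
    (S : Finset m) (i : m) : ℝ :=
  ∑ j ∈ S.erase i, |B i j| * rowRR B j / |B j j|

/-- The non-diagonally dominant index set `N₁(B)`, real version. -/
noncomputable def setN1R {m : Type*} [Fintype m] [DecidableEq m] (B : Matrix m m ℝ) : Finset m :=
  Finset.univ.filter fun i => |B i i| ≤ rowRR B i

/-- The diagonally dominant index set `N₂(B)`, real version. -/
noncomputable def setN2R {m : Type*} [Fintype m] [DecidableEq m] (B : Matrix m m ℝ) : Finset m :=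
  Finset.univ.filter fun i => rowRR B i < |B i i|

/-- `P_i(B) = R_i^{N₁}(B) + Q_i^{N₂}(B)`, real version. -/
noncomputable def PfunR {m : Type*} [Fintype m] [DecidableEq m] (B : Matrix m m ℝ) (i : m) : ℝ :=
  rowRSR B (setN1R B) i + rowQSR B (setN2R B) i

/-- `SDD₁` matrix, real version. -/
def IsSDD1R {m : Type*} [Fintype m] [DecidableEq m] (B : Matrix m m ℝ) : Prop :=
  ∀ i, PfunR B i < |B i i|

/-- Maximum absolute row sum (the `ℓ∞`-operator norm) of a real matrix. -/
noncomputable def infNormR {p q : Type*} [Fintype p] [Fintype q] (B : Matrix p q ℝ) : ℝ :=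
  ⨆ i, ∑ j, |B i j|

/-- `r_i = max{0, max_{j≠i} m_{ij}}`. -/
noncomputable def rOf {n : ℕ} (M : Matrix (Fin n) (Fin n) ℝ) (i : Fin n) : ℝ :=
  max 0 (⨆ j : {j : Fin n // j ≠ i}, M i (j : Fin n))

/-- The matrix `A = (m_{ij} − r_i)` in the decomposition `M = A + C` of a `B₁`-matrix. -/
noncomputable def matA {n : ℕ} (M : Matrix (Fin n) (Fin n) ℝ) : Matrix (Fin n) (Fin n) ℝ :=
  fun i j => M i j - rOf M i

/-- `φ̃ = max_{i,j∈N₂(A), i≠j} (max{1,a_{jj}} + R_i^{N₂}(A)) /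
min{1, a_{ii}, a_{jj}, a_{ii}a_{jj} − R_i^{N₂}(A)R_j^{N₂}(A)}`. -/
noncomputable def phiT {n : ℕ} (A : Matrix (Fin n) (Fin n) ℝ) : ℝ :=
  ⨆ p : {p : Fin n × Fin n // p.1 ∈ setN2R A ∧ p.2 ∈ setN2R A ∧ p.1 ≠ p.2},
    (max 1 (A p.1.2 p.1.2) + rowRSR A (setN2R A) p.1.1) /
      min (min 1 (A p.1.1 p.1.1))
        (min (A p.1.2 p.1.2)
          (A p.1.1 p.1.1 * A p.1.2 p.1.2 -
            rowRSR A (setN2R A) p.1.1 * rowRSR A (setN2R A) p.1.2))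

/-- `ψ̃ = max_{i∈N₁(A)} (1 + φ̃·R_i^{N₂}(A)) /
min{1, a_{ii} − R_i^{N₁}(A) − Σ_{j∈N₂}(|a_{ij}|/a_{jj})P_j(A)}`. -/
noncomputable def psiT {n : ℕ} (A : Matrix (Fin n) (Fin n) ℝ) : ℝ :=
  ⨆ i : ↥(setN1R A),
    (1 + phiT A * rowRSR A (setN2R A) (i : Fin n)) /
      min 1 (A (i : Fin n) (i : Fin n) - rowRSR A (setN1R A) (i : Fin n) -
        ∑ j ∈ setN2R A, |A (i : Fin n) j| / A j j * PfunR A j)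

section MonotoneMatrices

variable {m : Type*} [Fintype m] [DecidableEq m]

theorem mulVec_apply_eq_diag_sub {A : Matrix m m ℝ} (hA : ∀ i j, i ≠ j → A i j ≤ 0)
    (v : m → ℝ) (i : m) :
    (A *ᵥ v) i = A i i * v i - ∑ j ∈ univ.erase i, |A i j| * v j := by
  rw [mulVec, dotProduct, ← Finset.add_sum_erase _ _ (mem_univ i), sub_eq_add_neg,
    ← Finset.sum_neg_distrib]
  congr 1
  refine Finset.sum_congr rfl fun j hj => ?_
  rw [abs_of_nonpos (hA i j (Finset.ne_of_mem_erase hj).symm)]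
  ring

/-- A Z-matrix that maps some positive vector to a positive vector is monotone. -/
theorem nonneg_of_mulVec_nonneg {B : Matrix m m ℝ} (hB : ∀ i j, i ≠ j → B i j ≤ 0)
    {x : m → ℝ} (hx : ∀ i, 0 < x i) (hBx : ∀ i, 0 < (B *ᵥ x) i)
    {v : m → ℝ} (hv : ∀ i, 0 ≤ (B *ᵥ v) i) (k : m) : 0 ≤ v k := by
  obtain ⟨i, -, hi⟩ := Finset.exists_min_image univ (fun i => v i / x i) ⟨k, mem_univ k⟩
  by_contra! hk
  set t := v i / x i with ht
  have hle : ∀ j, t * x j ≤ v j := fun j => (le_div_iff₀ (hx j)).1 (hi j (mem_univ j))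
  have htneg : t < 0 := (hi k (mem_univ k)).trans_lt (div_neg_of_neg_of_pos hk (hx k))
  have hti : v i = t * x i := by rw [ht, div_mul_cancel₀ _ (hx i).ne']
  have h : (B *ᵥ v) i ≤ t * (B *ᵥ x) i := by
    rw [mulVec_apply_eq_diag_sub hB, mulVec_apply_eq_diag_sub hB, hti, mul_sub, Finset.mul_sum]
    have : ∑ j ∈ univ.erase i, t * (|B i j| * x j) ≤ ∑ j ∈ univ.erase i, |B i j| * v j :=
      Finset.sum_le_sum fun j _ => by
        have := mul_le_mul_of_nonneg_left (hle j) (abs_nonneg (B i j))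
        linarith
    linarith
  exact absurd (hv i) (not_le.2 (h.trans_lt (mul_neg_of_neg_of_pos htneg (hBx i))))

theorem det_ne_zero_of_mulVec_pos {B : Matrix m m ℝ} (hB : ∀ i j, i ≠ j → B i j ≤ 0)
    {x : m → ℝ} (hx : ∀ i, 0 < x i) (hBx : ∀ i, 0 < (B *ᵥ x) i) : B.det ≠ 0 := by
  intro h
  obtain ⟨v, hv0, hv⟩ := Matrix.exists_mulVec_eq_zero_iff.2 h
  refine hv0 (funext fun i => le_antisymm ?_ ?_)
  · have := nonneg_of_mulVec_nonneg hB hx hBx (v := -v) (by simp [mulVec_neg, hv]) i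
    simpa using this
  · exact nonneg_of_mulVec_nonneg hB hx hBx (v := v) (by simp [hv]) i

theorem exists_mulVec_eq {B : Matrix m m ℝ} (hB : B.det ≠ 0) (f : m → ℝ) :
    ∃ g, B *ᵥ g = f :=
  ⟨B⁻¹ *ᵥ f, by rw [mulVec_mulVec, Matrix.mul_nonsing_inv _ (isUnit_iff_ne_zero.2 hB),
    one_mulVec]⟩

theorem one_sub_diagonal_add_mulVec (d : m → ℝ) (A : Matrix m m ℝ) (v : m → ℝ) (i : m) :
    ((1 - diagonal d + diagonal d * A) *ᵥ v) i = (1 - d i) * v i + d i * (A *ᵥ v) i := by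
  rw [add_mulVec, sub_mulVec, one_mulVec, ← mulVec_mulVec, Pi.add_apply, Pi.sub_apply,
    mulVec_diagonal, mulVec_diagonal]
  ring

theorem one_sub_diagonal_add_nonpos {d : m → ℝ} (hd : ∀ i, 0 ≤ d i ∧ d i ≤ 1)
    {A : Matrix m m ℝ} (hA : ∀ i j, i ≠ j → A i j ≤ 0) (i j : m) (hij : i ≠ j) :
    (1 - diagonal d + diagonal d * A) i j ≤ 0 := by
  simpa [hij, diagonal_mul] using mul_nonpos_of_nonneg_of_nonpos (hd i).1 (hA i j hij)

/-- Perturbing a monotone matrix by a nonnegative matrix with constant rows multiplies the bound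
on the inverse by at most `n - 1`. -/
theorem abs_le_of_mulVec_add_const {B N : Matrix m m ℝ} (hB : ∀ i j, i ≠ j → B i j ≤ 0)
    (hcard : 2 ≤ Fintype.card m) {u : m → ℝ} (hu : ∀ i, 0 ≤ u i)
    (hN : ∀ y i, (N *ᵥ y) i = (B *ᵥ y) i + u i * ∑ j, y j)
    {x : m → ℝ} {K : ℝ} (hx : ∀ i, 0 < x i) (hxK : ∀ i, x i ≤ K) (hBx : ∀ i, 1 ≤ (B *ᵥ x) i)
    {ε : ℝ} (hε : 0 ≤ ε) {y : m → ℝ} (hy : ∀ i, |(N *ᵥ y) i| ≤ ε) (i : m) :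
    |y i| ≤ ((Fintype.card m : ℝ) - 1) * K * ε := by
  have hBx' : ∀ i, 0 < (B *ᵥ x) i := fun i => one_pos.trans_le (hBx i)
  have hdet := det_ne_zero_of_mulVec_pos hB hx hBx'
  obtain ⟨v, hv⟩ := exists_mulVec_eq hdet u
  have hv0 : ∀ i, 0 ≤ v i :=
    nonneg_of_mulVec_nonneg hB hx hBx' (v := v) (by simpa [hv] using hu)
  set s := ∑ j, y j with hs
  set σ := ∑ j, v j with hσ
  have hviσ : v i ≤ σ := Finset.single_le_sum (fun j _ => hv0 j) (mem_univ i)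
  set g : m → ℝ := y + s • v with hg
  have hBg : ∀ i, (B *ᵥ g) i = (N *ᵥ y) i := fun i => by
    rw [hN, hg, mulVec_add, mulVec_smul, hv, Pi.add_apply, Pi.smul_apply, smul_eq_mul, mul_comm s]
  have hgK : ∀ i, |g i| ≤ K * ε := fun i => by
    have hmul : ∀ i, ε ≤ ε * (B *ᵥ x) i := fun i => le_mul_of_one_le_right hε (hBx i)
    have h1 := nonneg_of_mulVec_nonneg hB hx hBx' (v := ε • x - g) (fun k => by
      rw [mulVec_sub, mulVec_smul, Pi.sub_apply, Pi.smul_apply, smul_eq_mul, hBg]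
      linarith [hmul k, (abs_le.1 (hy k)).2]) i
    have h2 := nonneg_of_mulVec_nonneg hB hx hBx' (v := ε • x + g) (fun k => by
      rw [mulVec_add, mulVec_smul, Pi.add_apply, Pi.smul_apply, smul_eq_mul, hBg]
      linarith [hmul k, (abs_le.1 (hy k)).1]) i
    simp only [Pi.sub_apply, Pi.add_apply, Pi.smul_apply, smul_eq_mul] at h1 h2
    have := mul_le_mul_of_nonneg_left (hxK i) hε
    exact abs_le.2 ⟨by linarith, by linarith⟩
  have hgs : ∑ j, g j = (1 + σ) * s := by
    simp only [hg, Pi.add_apply, Pi.smul_apply, smul_eq_mul, Finset.sum_add_distrib,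
      ← Finset.mul_sum, ← hs, ← hσ]
    ring
  have hpos : 0 < 1 + σ := by linarith [hv0 i]
  have hyi : (1 + σ) * y i = (1 + σ - v i) * g i - v i * ∑ j ∈ univ.erase i, g j := by
    have h := Finset.add_sum_erase univ g (mem_univ i)
    have hgi : g i = y i + s * v i := rfl
    have h' : ∑ j ∈ univ.erase i, g j = (1 + σ) * s - g i := by linarith
    rw [h', hgi]
    ring
  have hsum : |∑ j ∈ univ.erase i, g j| ≤ ((Fintype.card m : ℝ) - 1) * (K * ε) := by
    refine (Finset.abs_sum_le_sum_abs _ _).trans ((Finset.sum_le_sum fun j _ => hgK j).trans ?_)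
    rw [Finset.sum_const, Finset.card_erase_of_mem (mem_univ i), nsmul_eq_mul, Finset.card_univ,
      Nat.cast_sub (by omega), Nat.cast_one]
  have hc : (2 : ℝ) ≤ Fintype.card m := by exact_mod_cast hcard
  have hKε : 0 ≤ K * ε := (abs_nonneg _).trans (hgK i)
  have hkey : (1 + σ) * |y i| ≤ (1 + σ) * (((Fintype.card m : ℝ) - 1) * (K * ε)) := by
    rw [← abs_of_pos hpos, ← abs_mul, abs_of_pos hpos, hyi]
    have ha := abs_sub ((1 + σ - v i) * g i) (v i * ∑ j ∈ univ.erase i, g j)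
    rw [abs_mul, abs_mul, abs_of_nonneg (hv0 i),
      abs_of_nonneg (by linarith : 0 ≤ 1 + σ - v i)] at ha
    have h1 : (1 + σ - v i) * |g i| ≤ (1 + σ - v i) * (((Fintype.card m : ℝ) - 1) * (K * ε)) :=
      mul_le_mul_of_nonneg_left ((hgK i).trans (le_mul_of_one_le_left hKε (by linarith)))
        (by linarith)
    have h2 := mul_le_mul_of_nonneg_left hsum (hv0 i)
    linarith
  rw [mul_assoc]
  exact le_of_mul_le_mul_left hkey hpos

theorem infNormR_inv_le [Nonempty m] {N : Matrix m m ℝ} {L : ℝ}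
    (h : ∀ ε : ℝ, 0 ≤ ε → ∀ y : m → ℝ, (∀ i, |(N *ᵥ y) i| ≤ ε) → ∀ i, |y i| ≤ L * ε) :
    N.det ≠ 0 ∧ infNormR N⁻¹ ≤ L := by
  have hdet : N.det ≠ 0 := by
    intro h0
    obtain ⟨v, hv0, hv⟩ := Matrix.exists_mulVec_eq_zero_iff.2 h0
    refine hv0 (funext fun i => ?_)
    simpa using h 0 le_rfl v (by simp [hv]) i
  refine ⟨hdet, ciSup_le fun i => ?_⟩
  set f : m → ℝ := fun j => SignType.sign (N⁻¹ i j) with hf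
  have hNf : N *ᵥ (N⁻¹ *ᵥ f) = f := by
    rw [mulVec_mulVec, Matrix.mul_nonsing_inv _ (isUnit_iff_ne_zero.2 hdet), one_mulVec]
  have h1 := h 1 zero_le_one (N⁻¹ *ᵥ f) (fun j => by
    rw [hNf, hf]
    rcases lt_trichotomy (N⁻¹ i j) 0 with h | h | h <;> simp [h]) i
  have h2 : (N⁻¹ *ᵥ f) i = ∑ j, |N⁻¹ i j| :=
    Finset.sum_congr rfl fun j _ => by simp [hf]
  rw [h2, mul_one] at h1
  exact (le_abs_self _).trans h1

end MonotoneMatrices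

/-- A bilinear interpolation of four corner values is at least their minimum. -/
theorem min_le_bilinear {a b p s t μ : ℝ} (hs : 0 ≤ s ∧ s ≤ 1) (ht : 0 ≤ t ∧ t ≤ 1)
    (h1 : μ ≤ 1) (ha : μ ≤ a) (hb : μ ≤ b) (hab : μ ≤ a * b - p) :
    μ ≤ (1 - s + s * a) * (1 - t + t * b) - s * t * p := by
  have hs' : 0 ≤ 1 - s := by linarith
  have ht' : 0 ≤ 1 - t := by linarith
  nlinarith [mul_le_mul_of_nonneg_left h1 (mul_nonneg hs' ht'),
    mul_le_mul_of_nonneg_left ha (mul_nonneg hs.1 ht'),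
    mul_le_mul_of_nonneg_left hb (mul_nonneg hs' ht.1),
    mul_le_mul_of_nonneg_left hab (mul_nonneg hs.1 ht.1)]

section DiagonallyDominant

variable {m : Type*} [Fintype m] [DecidableEq m]

theorem exists_mulVec_eq_one_le [Nontrivial m] {A : Matrix m m ℝ}
    (hA : ∀ i j, i ≠ j → A i j ≤ 0) (hdom : ∀ i, rowRR A i < A i i)
    {d : m → ℝ} (hd : ∀ i, 0 ≤ d i ∧ d i ≤ 1) {Φ : ℝ}
    (hΦ : ∀ i j, i ≠ j → (max 1 (A j j) + rowRR A i) /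
      min (min 1 (A i i)) (min (A j j) (A i i * A j j - rowRR A i * rowRR A j)) ≤ Φ) :
    ∃ z : m → ℝ, (∀ i, 0 < z i) ∧ (∀ i, z i ≤ Φ) ∧
      ∀ i, (1 - d i) * z i + d i * (A *ᵥ z) i = 1 := by
  have hR : ∀ i, 0 ≤ rowRR A i := fun i => Finset.sum_nonneg fun _ _ => abs_nonneg _
  have hpos : ∀ i, 0 < A i i := fun i => (hR i).trans_lt (hdom i)
  have hdiag : ∀ i, 0 < 1 - d i + d i * (A i i - rowRR A i) := fun i => by
    have h := hd i
    rcases h.1.eq_or_lt with h0 | h0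
    · simp [← h0]
    · have := mul_pos h0 (sub_pos.2 (hdom i))
      linarith
  have hB := one_sub_diagonal_add_nonpos hd hA
  have hB1 : ∀ i, 0 < ((1 - diagonal d + diagonal d * A) *ᵥ fun _ => (1 : ℝ)) i := fun i => by
    rw [one_sub_diagonal_add_mulVec, mulVec_apply_eq_diag_sub hA]
    simpa [rowRR] using hdiag i
  have hone : ∀ _ : m, (0 : ℝ) < 1 := fun _ => one_pos
  obtain ⟨z, hz⟩ := exists_mulVec_eq (det_ne_zero_of_mulVec_pos hB hone hB1) fun _ => (1 : ℝ)
  have hz0 : ∀ i, 0 ≤ z i :=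
    nonneg_of_mulVec_nonneg hB hone hB1 (v := z) (by simp [hz])
  have heq : ∀ i, (1 - d i) * z i + d i * (A *ᵥ z) i = 1 := fun i => by
    rw [← one_sub_diagonal_add_mulVec, hz]
  have hrow : ∀ i, (1 - d i + d i * A i i) * z i =
      1 + d i * ∑ j ∈ univ.erase i, |A i j| * z j := fun i => by
    have := heq i
    rw [mulVec_apply_eq_diag_sub hA] at this
    linarith
  have hã : ∀ i, 0 < 1 - d i + d i * A i i := fun i => by
    have := mul_nonneg (hd i).1 (hR i)
    linarith [hdiag i]
  refine ⟨z, fun i => ?_, ?_, heq⟩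
  · refine pos_of_mul_pos_right (a := 1 - d i + d i * A i i) ?_ (hã i).le
    rw [hrow]
    have := mul_nonneg (hd i).1
      (Finset.sum_nonneg fun j (_ : j ∈ univ.erase i) => mul_nonneg (abs_nonneg (A i j)) (hz0 j))
    linarith
  obtain ⟨i, -, hi⟩ := Finset.exists_max_image univ z univ_nonempty
  obtain ⟨k, hk⟩ := exists_ne i
  obtain ⟨j, hj, hjmax⟩ := Finset.exists_max_image (univ.erase i) z
    ⟨k, Finset.mem_erase.2 ⟨hk, mem_univ k⟩⟩
  have hij : i ≠ j := (Finset.ne_of_mem_erase hj).symm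
  have hbound : ∀ k t, (∀ l ∈ univ.erase k, z l ≤ t) →
      (1 - d k + d k * A k k) * z k ≤ 1 + d k * (rowRR A k * t) := fun k t ht => by
    rw [hrow, rowRR, Finset.sum_mul]
    have := mul_le_mul_of_nonneg_left (Finset.sum_le_sum fun l hl =>
      mul_le_mul_of_nonneg_left (ht l hl) (abs_nonneg (A k l))) (hd k).1
    linarith
  have hbi := hbound i (z j) hjmax
  have hbj := hbound j (z i) fun l _ => hi l (mem_univ l)
  refine fun l => (hi l (mem_univ l)).trans (le_trans ?_ (hΦ i j hij))
  set μ := min (min 1 (A i i)) (min (A j j) (A i i * A j j - rowRR A i * rowRR A j)) with hμ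
  have hμ1 : μ ≤ 1 := (min_le_left _ _).trans (min_le_left _ _)
  have hμi : μ ≤ A i i := (min_le_left _ _).trans (min_le_right _ _)
  have hμj : μ ≤ A j j := (min_le_right _ _).trans (min_le_left _ _)
  have hμij : μ ≤ A i i * A j j - rowRR A i * rowRR A j :=
    (min_le_right _ _).trans (min_le_right _ _)
  have hμ0 : 0 < μ := lt_min (lt_min one_pos (hpos i)) (lt_min (hpos j)
    (sub_pos.2 (mul_lt_mul'' (hdom i) (hdom j) (hR i) (hR j))))
  rw [le_div_iff₀ hμ0]
  have hden := min_le_bilinear (hd i) (hd j) hμ1 hμi hμj hμij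
  have hãj : 1 - d j + d j * A j j ≤ max 1 (A j j) := by
    have h1 := mul_le_mul_of_nonneg_left (le_max_left 1 (A j j)) (sub_nonneg.2 (hd j).2)
    have h2 := mul_le_mul_of_nonneg_left (le_max_right 1 (A j j)) (hd j).1
    linarith
  have hdR : d i * rowRR A i ≤ rowRR A i := mul_le_of_le_one_left (hR i) (hd i).2
  have h1 := mul_le_mul_of_nonneg_left hbi (hã j).le
  have h2 := mul_le_mul_of_nonneg_left hbj (mul_nonneg (hd i).1 (hR i))
  have h3 := mul_le_mul_of_nonneg_left hden (hz0 i)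
  linarith

end DiagonallyDominant

section SDD1

variable {m : Type*} [Fintype m] [DecidableEq m]

theorem mem_setN1R_iff {A : Matrix m m ℝ} {i : m} : i ∈ setN1R A ↔ i ∉ setN2R A := by
  simp [setN1R, setN2R]

theorem sum_erase_setN1R_add_setN2R (A : Matrix m m ℝ) (f : m → ℝ) (i : m) :
    ∑ j ∈ univ.erase i, f j =
      ∑ j ∈ (setN1R A).erase i, f j + ∑ j ∈ (setN2R A).erase i, f j := by
  rw [← Finset.sum_union]
  · congr 1
    ext j
    simp only [Finset.mem_union, Finset.mem_erase, mem_univ, mem_setN1R_iff]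
    tauto
  · refine Finset.disjoint_left.2 fun j h1 h2 => ?_
    exact mem_setN1R_iff.1 (Finset.mem_of_mem_erase h1) (Finset.mem_of_mem_erase h2)

theorem rowRSR_nonneg (A : Matrix m m ℝ) (S : Finset m) (i : m) : 0 ≤ rowRSR A S i :=
  Finset.sum_nonneg fun _ _ => abs_nonneg _

theorem rowRR_nonneg (A : Matrix m m ℝ) (i : m) : 0 ≤ rowRR A i :=
  Finset.sum_nonneg fun _ _ => abs_nonneg _

theorem rowRR_eq_add (A : Matrix m m ℝ) (i : m) :
    rowRR A i = rowRSR A (setN1R A) i + rowRSR A (setN2R A) i :=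
  sum_erase_setN1R_add_setN2R A _ i

theorem PfunR_nonneg (A : Matrix m m ℝ) (i : m) : 0 ≤ PfunR A i :=
  add_nonneg (rowRSR_nonneg A _ i) (Finset.sum_nonneg fun _ _ =>
    div_nonneg (mul_nonneg (abs_nonneg _) (rowRR_nonneg A _)) (abs_nonneg _))

theorem PfunR_le_rowRR (A : Matrix m m ℝ) (i : m) : PfunR A i ≤ rowRR A i := by
  rw [rowRR_eq_add, PfunR]
  refine add_le_add_right (Finset.sum_le_sum fun j hj => ?_) _
  have hj' : rowRR A j < |A j j| := (Finset.mem_filter.1 (Finset.mem_of_mem_erase hj)).2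
  rw [mul_div_assoc]
  exact mul_le_of_le_one_right (abs_nonneg _)
    (div_le_one_of_le₀ hj'.le (abs_nonneg _))

/-- The weight vector `w` equal to `1` on `N₁` and to `P_i / a_{ii}` on `N₂`. -/
noncomputable def weightR (A : Matrix m m ℝ) (i : m) : ℝ :=
  if i ∈ setN2R A then PfunR A i / A i i else 1

theorem sum_erase_mul_weightR (A : Matrix m m ℝ) (i : m) :
    ∑ j ∈ univ.erase i, |A i j| * weightR A j =
      rowRSR A (setN1R A) i + ∑ j ∈ (setN2R A).erase i, |A i j| * (PfunR A j / A j j) := by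
  rw [sum_erase_setN1R_add_setN2R A, rowRSR]
  congr 1
  · refine Finset.sum_congr rfl fun j hj => ?_
    rw [weightR, if_neg (mem_setN1R_iff.1 (Finset.mem_of_mem_erase hj)), mul_one]
  · refine Finset.sum_congr rfl fun j hj => ?_
    rw [weightR, if_pos (Finset.mem_of_mem_erase hj)]

theorem sum_erase_mul_weightR_le {A : Matrix m m ℝ} (hpos : ∀ i, 0 < A i i) (i : m) :
    ∑ j ∈ univ.erase i, |A i j| * weightR A j ≤ PfunR A i := by
  rw [sum_erase_mul_weightR, PfunR]
  refine add_le_add_right (Finset.sum_le_sum fun j _ => ?_) _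
  rw [mul_div_assoc, abs_of_pos (hpos j)]
  exact mul_le_mul_of_nonneg_left
    (div_le_div_of_nonneg_right (PfunR_le_rowRR A j) (hpos j).le) (abs_nonneg _)

end SDD1

theorem exists_mulVec_ge_one_of_SDD1 {n : ℕ} {A : Matrix (Fin n) (Fin n) ℝ}
    (hA : ∀ i j, i ≠ j → A i j ≤ 0) (hSDD1 : IsSDD1R A) (hpos : ∀ i, 0 < A i i)
    (hN1 : (setN1R A).Nonempty) (hN2 : 2 ≤ (setN2R A).card)
    {d : Fin n → ℝ} (hd : ∀ i, 0 ≤ d i ∧ d i ≤ 1) :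
    ∃ x : Fin n → ℝ, (∀ i, 0 < x i) ∧
      (∀ i, x i ≤ (1 + ⨆ i : ↥(setN2R A), PfunR A (i : Fin n) / A (i : Fin n) (i : Fin n)) *
        max (phiT A) (psiT A)) ∧
      ∀ i, 1 ≤ ((1 - diagonal d + diagonal d * A) *ᵥ x) i := by
  set S := setN2R A with hS
  have hsub : ∀ i : S, rowRR (A.submatrix (Subtype.val : S → Fin n) Subtype.val) i =
      rowRSR A S i := fun i => by
    rw [rowRR, rowRSR, Finset.sum_erase_eq_sub (mem_univ i), Finset.sum_erase_eq_sub i.2,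
      ← Finset.sum_coe_sort S]
    rfl
  have hphi : ∀ i j : S, i ≠ j → (max 1 (A j j) + rowRSR A S i) /
      min (min 1 (A i i)) (min (A j j) (A i i * A j j - rowRSR A S i * rowRSR A S j)) ≤
        phiT A := fun i j hij =>
    le_ciSup (f := fun p : {p : Fin n × Fin n // p.1 ∈ S ∧ p.2 ∈ S ∧ p.1 ≠ p.2} =>
      (max 1 (A p.1.2 p.1.2) + rowRSR A S p.1.1) / min (min 1 (A p.1.1 p.1.1))
        (min (A p.1.2 p.1.2) (A p.1.1 p.1.1 * A p.1.2 p.1.2 -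
          rowRSR A S p.1.1 * rowRSR A S p.1.2))) (Set.finite_range _).bddAbove
      ⟨(i, j), i.2, j.2, fun h => hij (Subtype.ext h)⟩
  have : Nontrivial S := Fintype.one_lt_card_iff_nontrivial.1 (by
    rw [Fintype.card_coe]
    exact hN2)
  have hdomS : ∀ i : S, rowRR (A.submatrix (Subtype.val : S → Fin n) Subtype.val) i <
      A i i := fun i => by
    have h : rowRR A i < |A i i| := (Finset.mem_filter.1 i.2).2
    rw [abs_of_pos (hpos i), rowRR_eq_add] at h
    rw [hsub]
    linarith [rowRSR_nonneg A (setN1R A) i]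
  obtain ⟨z, hz0, hzΦ, hz⟩ := exists_mulVec_eq_one_le
    (A := A.submatrix (Subtype.val : S → Fin n) Subtype.val)
    (fun i j hij => hA i j fun h => hij (Subtype.ext h)) hdomS
    (d := fun i => d i) (fun i => hd i) (Φ := phiT A)
    (fun i j hij => by simpa only [hsub, submatrix_apply] using hphi i j hij)
  have hphi0 : 0 < phiT A := by
    obtain ⟨k⟩ := (inferInstance : Nonempty S)
    exact (hz0 k).trans_le (hzΦ k)
  set δ : Fin n → ℝ := fun i => A i i - rowRSR A (setN1R A) i -
    ∑ j ∈ S, |A i j| / A j j * PfunR A j with hδ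
  set w := weightR A with hw
  have hAw1 : ∀ i ∉ S, (A *ᵥ w) i = δ i := fun i hi => by
    rw [mulVec_apply_eq_diag_sub hA, sum_erase_mul_weightR, Finset.erase_eq_of_notMem hi, hw,
      weightR, if_neg hi, mul_one, hδ, sub_add_eq_sub_sub]
    congr 1
    exact Finset.sum_congr rfl fun j _ => by ring
  have hAw2 : ∀ i ∈ S, 0 ≤ (A *ᵥ w) i := fun i hi => by
    rw [mulVec_apply_eq_diag_sub hA, hw, weightR, if_pos hi, mul_div_cancel₀ _ (hpos i).ne']
    exact sub_nonneg.2 (sum_erase_mul_weightR_le hpos i)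
  have hδ0 : ∀ i ∉ S, 0 < δ i := fun i hi => by
    rw [← hAw1 i hi, mulVec_apply_eq_diag_sub hA]
    have h := hSDD1 i
    rw [abs_of_pos (hpos i)] at h
    have h' := sum_erase_mul_weightR_le hpos i
    have : w i = 1 := by rw [hw, weightR, if_neg hi]
    rw [this]
    linarith
  have hpsi : ∀ i ∉ S, 1 ≤ psiT A ∧ 1 + phiT A * rowRSR A S i ≤ psiT A * δ i := fun i hi => by
    have h : (1 + phiT A * rowRSR A S i) / min 1 (δ i) ≤ psiT A :=
      le_ciSup (f := fun i : ↥(setN1R A) =>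
        (1 + phiT A * rowRSR A S (i : Fin n)) / min 1 (δ i)) (Set.finite_range _).bddAbove
        ⟨i, mem_setN1R_iff.2 hi⟩
    have hmin : 0 < min 1 (δ i) := lt_min one_pos (hδ0 i hi)
    rw [div_le_iff₀ hmin] at h
    have hn : 0 ≤ phiT A * rowRSR A S i := mul_nonneg hphi0.le (rowRSR_nonneg A S i)
    have hpsi0 : 0 < psiT A := pos_of_mul_pos_left (by linarith) hmin.le
    have h1 := mul_le_mul_of_nonneg_left (min_le_left 1 (δ i)) hpsi0.le
    have h2 := mul_le_mul_of_nonneg_left (min_le_right 1 (δ i)) hpsi0.le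
    exact ⟨by linarith, by linarith⟩
  obtain ⟨i₁, hi₁⟩ := hN1
  have hpsi1 : 1 ≤ psiT A := (hpsi i₁ (mem_setN1R_iff.1 hi₁)).1
  have hw0 : ∀ i, 0 ≤ w i := fun i => by
    rw [hw, weightR]
    split_ifs
    · exact div_nonneg (PfunR_nonneg A i) (hpos i).le
    · exact zero_le_one
  set W := ⨆ i : S, PfunR A (i : Fin n) / A (i : Fin n) (i : Fin n) with hW
  have hwW : ∀ i ∈ S, w i ≤ W := fun i hi => by
    rw [hw, weightR, if_pos hi]
    exact le_ciSup (f := fun i : S => PfunR A (i : Fin n) / A (i : Fin n) (i : Fin n))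
      (Set.finite_range _).bddAbove ⟨i, hi⟩
  have hW0 : 0 ≤ W := by
    obtain ⟨k⟩ := (inferInstance : Nonempty S)
    exact (hw0 k).trans (hwW k k.2)
  set ζ : Fin n → ℝ := fun i => if h : i ∈ S then z ⟨i, h⟩ else 0 with hζ
  have hζS : ∀ i : S, ζ i = z i := fun i => by simp [hζ]
  have hζN : ∀ i ∉ S, ζ i = 0 := fun i hi => by simp [hζ, hi]
  have hAζ : ∀ i, (A *ᵥ ζ) i = ∑ j : S, A i j * z j := fun i => by
    rw [mulVec, dotProduct, ← Finset.sum_subset (Finset.subset_univ S)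
      (fun j _ hj => by rw [hζN j hj, mul_zero]), ← Finset.sum_coe_sort]
    exact Finset.sum_congr rfl fun j _ => by rw [hζS]
  have hAζN : ∀ i ∉ S, -(phiT A * rowRSR A S i) ≤ (A *ᵥ ζ) i := fun i hi => by
    rw [hAζ, rowRSR, Finset.erase_eq_of_notMem hi, ← Finset.sum_coe_sort, Finset.mul_sum,
      ← Finset.sum_neg_distrib]
    refine Finset.sum_le_sum fun j _ => ?_
    have hj : A i j ≤ 0 := hA i j fun h => hi (h ▸ j.2)
    rw [abs_of_nonpos hj]
    have := mul_le_mul_of_nonpos_left (hzΦ j) hj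
    linarith
  refine ⟨psiT A • w + ζ, fun i => ?_, fun i => ?_, fun i => ?_⟩
  · rw [Pi.add_apply, Pi.smul_apply, smul_eq_mul]
    by_cases hi : i ∈ S
    · rw [hζS ⟨i, hi⟩]
      exact add_pos_of_nonneg_of_pos (mul_nonneg (by linarith) (hw0 i)) (hz0 _)
    · rw [hζN i hi, hw, weightR, if_neg hi]
      linarith
  · rw [Pi.add_apply, Pi.smul_apply, smul_eq_mul, add_mul, one_mul, add_comm]
    have hmax : psiT A ≤ max (phiT A) (psiT A) := le_max_right _ _
    by_cases hi : i ∈ S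
    · rw [hζS ⟨i, hi⟩]
      refine add_le_add ((hzΦ _).trans (le_max_left _ _)) ?_
      rw [mul_comm]
      exact mul_le_mul (hwW i hi) hmax (by linarith) hW0
    · have := mul_nonneg hW0 (by linarith : 0 ≤ max (phiT A) (psiT A))
      rw [hζN i hi, hw, weightR, if_neg hi]
      linarith
  · rw [one_sub_diagonal_add_mulVec, mulVec_add, mulVec_smul]
    simp only [Pi.add_apply, Pi.smul_apply, smul_eq_mul]
    have hd0 := (hd i).1
    have hd1 : 0 ≤ 1 - d i := sub_nonneg.2 (hd i).2
    by_cases hi : i ∈ S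
    · have h : (1 - d i) * ζ i + d i * (A *ᵥ ζ) i = 1 := by
        rw [hζS ⟨i, hi⟩, hAζ]
        exact hz ⟨i, hi⟩
      have h1 := mul_nonneg hd1 (mul_nonneg (by linarith : 0 ≤ psiT A) (hw0 i))
      have h2 := mul_nonneg hd0 (mul_nonneg (by linarith : 0 ≤ psiT A) (hAw2 i hi))
      linarith
    · have h1 : 1 ≤ psiT A * w i + ζ i := by
        rw [hζN i hi, hw, weightR, if_neg hi]
        linarith
      have h2 : 1 ≤ psiT A * (A *ᵥ w) i + (A *ᵥ ζ) i := by
        rw [hAw1 i hi]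
        linarith [(hpsi i hi).2, hAζN i hi]
      have h3 := mul_le_mul_of_nonneg_left h1 hd1
      have h4 := mul_le_mul_of_nonneg_left h2 hd0
      linarith

theorem matA_nonpos {n : ℕ} (M : Matrix (Fin n) (Fin n) ℝ) (i j : Fin n) (hij : i ≠ j) :
    matA M i j ≤ 0 :=
  sub_nonpos.2 ((le_ciSup (f := fun j : {j : Fin n // j ≠ i} => M i (j : Fin n))
    (Set.finite_range _).bddAbove ⟨j, hij.symm⟩).trans (le_max_right _ _))

theorem mulVec_eq_matA_add {n : ℕ} (M : Matrix (Fin n) (Fin n) ℝ) (y : Fin n → ℝ) (i : Fin n) :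
    (M *ᵥ y) i = (matA M *ᵥ y) i + rOf M i * ∑ j, y j := by
  simp only [mulVec, dotProduct, matA, Finset.mul_sum, ← Finset.sum_add_distrib]
  exact Finset.sum_congr rfl fun j _ => by ring

/-- If `M` is a `B₁`-matrix (i.e. `A = matA M` is `SDD₁` with positive diagonal),
`N₁(A) ≠ ∅` and `|N₂(A)| ≥ 2`, then for every `D = diag(d)` with `0 ≤ d_i ≤ 1`, the matrix
`I − D + DM` is nonsingular and
`‖(I − D + DM)⁻¹‖_∞ ≤ (n−1)·(1 + max_{i∈N₂(A)} P_i(A)/a_{ii})·max{φ̃, ψ̃}`. -/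
theorem stmt15 {n : ℕ} (hn : 2 ≤ n) (M : Matrix (Fin n) (Fin n) ℝ)
    (hSDD1 : IsSDD1R (matA M)) (hpos : ∀ i, 0 < matA M i i)
    (hN1 : (setN1R (matA M)).Nonempty) (hN2 : 2 ≤ (setN2R (matA M)).card)
    (d : Fin n → ℝ) (hd : ∀ i, 0 ≤ d i ∧ d i ≤ 1) :
    (1 - Matrix.diagonal d + Matrix.diagonal d * M).det ≠ 0 ∧
      infNormR (1 - Matrix.diagonal d + Matrix.diagonal d * M)⁻¹ ≤
        ((n : ℝ) - 1) *
          ((1 + ⨆ i : ↥(setN2R (matA M)),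
              PfunR (matA M) (i : Fin n) / matA M (i : Fin n) (i : Fin n)) *
            max (phiT (matA M)) (psiT (matA M))) := by
  have hA := matA_nonpos M
  obtain ⟨x, hx, hxK, hBx⟩ := exists_mulVec_ge_one_of_SDD1 hA hSDD1 hpos hN1 hN2 hd
  have : Nonempty (Fin n) := ⟨hN1.choose⟩
  refine infNormR_inv_le fun ε hε y hy i => ?_
  have h := abs_le_of_mulVec_add_const (one_sub_diagonal_add_nonpos hd hA) (by simpa using hn)
    (u := fun i => d i * rOf M i) (fun i => mul_nonneg (hd i).1 (le_max_left _ _))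
    (fun y i => by
      rw [one_sub_diagonal_add_mulVec, one_sub_diagonal_add_mulVec, mulVec_eq_matA_add]
      ring) hx hxK hBx hε hy i
  rwa [Fintype.card_fin] at h
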